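/- arXiv:2406.06065 — 4 statements merged into one kernel-verified Lean document; each statement's English description precedes it below -/
import Mathlib

section
/- Let d ≥ 1 and let Q_1, …, Q_n be cubes with Q_j = [0, a_j]^d (a_j > 0) such that the sum of their Lebesgue measures satisfies Σ_{j=1}^n λ(Q_j) ≥ 1. Then the cube [0, 1/2]^d can be covered by translates of the cubes Q_1, …, Q_n, i.e. there exist points x_1, …, x_n ∈ ℝ^d with [0,1/2]^d ⊆ ⋃_{j=1}^n (Q_j + x_j). -/
open MeasureTheory Set

/-- A cube of side `2 * h` is the union of `2 ^ d` cubes of side `h`. -/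
theorem exists_mem_half_cube {d : ℕ} {v x : Fin d → ℝ} {h : ℝ}
    (hx : ∀ i, x i ∈ Icc (v i) (v i + 2 * h)) :
    ∃ e : Fin d → Bool, ∀ i, x i ∈
      Icc (v i + if e i then h else 0) ((v i + if e i then h else 0) + h) := by
  refine ⟨fun i => decide (v i + h ≤ x i), fun i => ?_⟩
  obtain ⟨h₁, h₂⟩ := hx i
  by_cases hi : v i + h ≤ x i
  · rw [if_pos (decide_eq_true hi)]
    exact ⟨hi, by linarith⟩
  · rw [if_neg (by simpa using hi), add_zero]
    constructor <;> linarith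

/-- Cubes of sides `a j ∈ [δ, 2 * h]` can be translated to cover a finite family `A` of cubes of
side `h`, provided that the cubes of sides `a j / 2` have at least the total volume of `A`. -/
theorem exists_translates_cover {ι : Type*} [DecidableEq ι] {d : ℕ} {a : ι → ℝ} {δ : ℝ}
    (M : ℕ) (S : Finset ι) (A : Finset (Fin d → ℝ)) (h : ℝ) (hh : 0 < h)
    (hM : 2 * h < 2 ^ M * δ) (hS : ∀ j ∈ S, δ ≤ a j ∧ a j ≤ 2 * h)
    (hA : (A.card : ℝ) * h ^ d ≤ ∑ j ∈ S, (a j / 2) ^ d) :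
    ∃ c : ι → Fin d → ℝ, ∀ v ∈ A, ∀ x : Fin d → ℝ, (∀ i, x i ∈ Icc (v i) (v i + h)) →
      ∃ j ∈ S, ∀ i, x i ∈ Icc (c j i) (c j i + a j) := by
  induction M generalizing S A h with
  | zero =>
    have hSe : S = ∅ := Finset.eq_empty_of_forall_notMem fun j hj => by
      have := hS j hj
      linarith
    subst hSe
    have hAe : A = ∅ := by
      by_contra hne
      have : (0 : ℝ) < A.card := by
        exact_mod_cast Finset.card_pos.mpr (Finset.nonempty_iff_ne_empty.mpr hne)
      have := mul_pos this (pow_pos hh d)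
      simp only [Finset.sum_empty] at hA
      linarith
    exact ⟨0, by simp [hAe]⟩
  | succ M ihM =>
    induction S using Finset.strongInduction generalizing A with
    | H S ihS =>
    rcases A.eq_empty_or_nonempty with rfl | ⟨v, hv⟩
    · exact ⟨0, by simp⟩
    by_cases hlarge : ∃ j ∈ S, h ≤ a j
    · obtain ⟨j, hj, haj⟩ := hlarge
      have hcard : ((A.erase v).card : ℝ) + 1 = A.card := by
        exact_mod_cast Finset.card_erase_add_one hv
      have hpow : (a j / 2) ^ d ≤ h ^ d :=
        pow_le_pow_left₀ (by linarith) (by linarith [hS j hj]) d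
      obtain ⟨c, hc⟩ := ihS (S.erase j) (Finset.erase_ssubset hj) (A.erase v)
        (fun k hk => hS k (Finset.mem_of_mem_erase hk)) (by
          rw [← hcard, ← Finset.add_sum_erase S _ hj] at hA
          linarith)
      refine ⟨Function.update c j v, fun w hw x hx => ?_⟩
      by_cases hwv : w = v
      · subst hwv
        refine ⟨j, hj, fun i => ?_⟩
        rw [Function.update_self]
        exact ⟨(hx i).1, by linarith [(hx i).2]⟩
      · obtain ⟨k, hk, hxk⟩ := hc w (Finset.mem_erase.mpr ⟨hwv, hw⟩) x hx
        refine ⟨k, Finset.mem_of_mem_erase hk, ?_⟩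
        rwa [Function.update_of_ne (Finset.ne_of_mem_erase hk)]
    · push Not at hlarge
      let corner : (Fin d → ℝ) × (Fin d → Bool) → Fin d → ℝ :=
        fun p i => p.1 i + if p.2 i then h / 2 else 0
      have hcard : (((A ×ˢ Finset.univ).image corner).card : ℝ) ≤ A.card * 2 ^ d := by
        have := Finset.card_image_le (s := A ×ˢ Finset.univ) (f := corner)
        rw [Finset.card_product] at this
        simp only [Finset.card_univ, Fintype.card_fun, Fintype.card_bool, Fintype.card_fin] at this
        exact_mod_cast this
      obtain ⟨c, hc⟩ := ihM S ((A ×ˢ Finset.univ).image corner) (h / 2) (by linarith)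
        (by rw [pow_succ] at hM; linarith)
        (fun j hj => ⟨(hS j hj).1, by linarith [hlarge j hj]⟩) (by
          calc _ ≤ (A.card * 2 ^ d : ℝ) * (h / 2) ^ d := by gcongr
            _ = A.card * h ^ d := by rw [mul_assoc, ← mul_pow]; congr 2; ring
            _ ≤ _ := hA)
      refine ⟨c, fun w hw x hx => ?_⟩
      obtain ⟨e, he⟩ := exists_mem_half_cube (v := w) (x := x) (h := h / 2) fun i => by
        rw [mul_div_cancel₀ h two_ne_zero]
        exact hx i
      exact hc (corner (w, e)) (Finset.mem_image_of_mem _ (by simp [hw])) x he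

/-- The cube of side `s` in `d`-dimensional Euclidean space has volume `s ^ d`. -/
theorem EuclideanSpace.volume_cube (d : ℕ) (s : ℝ) :
    volume {x : EuclideanSpace ℝ (Fin d) | ∀ i, x i ∈ Icc 0 s} = ENNReal.ofReal s ^ d := by
  have hset : {x : EuclideanSpace ℝ (Fin d) | ∀ i, x i ∈ Icc 0 s} =
      WithLp.ofLp ⁻¹' Icc (0 : Fin d → ℝ) (fun _ => s) := by
    ext x
    simp [Pi.le_def, forall_and]
  rw [hset, (PiLp.volume_preserving_ofLp (Fin d)).measure_preimage
    measurableSet_Icc.nullMeasurableSet, Real.volume_Icc_pi]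
  simp



/-- Given cubes `Q_j = [0, a_j]^d` with total Lebesgue measure at least `1`, the cube
`[0, 1/2]^d` can be covered by translates of the cubes `Q_j`. -/
theorem cube_covered_by_translates (d : ℕ) (hd : 1 ≤ d) (n : ℕ) (a : Fin n → ℝ)
    (ha : ∀ j, 0 < a j)
    (hsum : 1 ≤ ∑ j : Fin n,
      volume {x : EuclideanSpace ℝ (Fin d) | ∀ i, x i ∈ Set.Icc 0 (a j)}) :
    ∃ c : Fin n → EuclideanSpace ℝ (Fin d),
      {x : EuclideanSpace ℝ (Fin d) | ∀ i, x i ∈ Set.Icc (0:ℝ) (1/2)} ⊆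
        ⋃ j : Fin n, (fun y => y + c j) '' {x | ∀ i, x i ∈ Set.Icc 0 (a j)} := by
  have hsum' : (1 : ℝ) ≤ ∑ j, a j ^ d := by
    simp only [EuclideanSpace.volume_cube, ← ENNReal.ofReal_pow (ha _).le] at hsum
    rw [← ENNReal.ofReal_sum_of_nonneg fun j _ => (pow_pos (ha j) d).le] at hsum
    exact ENNReal.one_le_ofReal.mp hsum
  suffices hcover : ∃ c : Fin n → Fin d → ℝ, ∀ x : Fin d → ℝ,
      (∀ i, x i ∈ Icc (0 : ℝ) (1 / 2)) → ∃ j, ∀ i, x i ∈ Icc (c j i) (c j i + a j) by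
    obtain ⟨c, hc⟩ := hcover
    refine ⟨fun j => WithLp.toLp 2 (c j), fun x hx => ?_⟩
    obtain ⟨j, hj⟩ := hc x hx
    refine mem_iUnion.mpr ⟨j, x - WithLp.toLp 2 (c j), fun i => ?_, sub_add_cancel _ _⟩
    simp only [PiLp.sub_apply, mem_Icc]
    constructor <;> linarith [(hj i).1, (hj i).2]
  by_cases hlarge : ∃ j, 1 / 2 ≤ a j
  · obtain ⟨j, hj⟩ := hlarge
    refine ⟨0, fun x hx => ⟨j, fun i => ?_⟩⟩
    simp only [Pi.zero_apply, zero_add]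
    exact ⟨(hx i).1, (hx i).2.trans hj⟩
  push Not at hlarge
  obtain ⟨δ, hδ, hδa⟩ : ∃ δ > 0, ∀ j, δ ≤ a j := by
    rcases isEmpty_or_nonempty (Fin n) with _ | _
    · exact ⟨1, one_pos, fun j => isEmptyElim j⟩
    · obtain ⟨j, hj⟩ := Finite.exists_min a
      exact ⟨a j, ha j, hj⟩
  obtain ⟨M, hM⟩ := pow_unbounded_of_one_lt (1 / δ) (one_lt_two (α := ℝ))
  obtain ⟨c, hc⟩ := exists_translates_cover M Finset.univ {(0 : Fin d → ℝ)} (1 / 2)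
    (by norm_num) (by rw [div_lt_iff₀ hδ] at hM; linarith)
    (fun j _ => ⟨hδa j, by linarith [hlarge j]⟩) (by
      simp only [Finset.card_singleton, Nat.cast_one, one_mul, div_pow, one_pow,
        ← Finset.sum_div]
      gcongr)
  refine ⟨c, fun x hx => ?_⟩
  obtain ⟨j, -, hj⟩ := hc 0 (Finset.mem_singleton_self _) x (by simpa using hx)
  exact ⟨j, hj⟩
end

section
/- Let d ≥ 1, let h : [0,∞) → [0,∞] be a right-continuous increasing function with h(0) = 0, and let ν be the Hausdorff measure corresponding to h, restricted to the Borel σ-algebra of ℝ^d. If there exists a compact set K ⊆ ℝ^d such that ν(K) = λ(K) and 0 < λ(K) < ∞, then ν coincides with the Lebesgue measure λ on all Borel sets. -/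
open MeasureTheory Set ENNReal

open Filter Topology Metric
open scoped NNReal

/-- Measures obtained from a gauge function are invariant under translations. -/
theorem isAddLeftInvariant_mkMetric {E : Type*} [NormedAddCommGroup E] [MeasurableSpace E]
    [BorelSpace E] (h : ℝ≥0∞ → ℝ≥0∞) :
    (Measure.mkMetric h : Measure E).IsAddLeftInvariant := by
  refine ⟨fun g => Measure.ext fun s hs => ?_⟩
  rw [Measure.map_apply (measurable_const_add g) hs, ← OuterMeasure.coe_mkMetric]
  exact DFunLike.congr_fun
    (OuterMeasure.isometryEquiv_map_mkMetric h (IsometryEquiv.addLeft g)) s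

/-- The open unit cube is covered by `n ^ d` cubes of diameter at most `C / n`. -/
theorem exists_cover_unit_cube (d : ℕ) : ∃ C : ℝ≥0, ∀ n : ℕ, 0 < n →
    ∃ t : (Fin d → Fin n) → Set (EuclideanSpace ℝ (Fin d)),
      (∀ f, ediam (t f) ≤ (C / n : ℝ≥0)) ∧
      {x : EuclideanSpace ℝ (Fin d) | ∀ i, x i ∈ Ioo (0 : ℝ) 1} ⊆ ⋃ f, t f := by
  have hL := PiLp.lipschitzWith_toLp 2 (fun _ : Fin d => ℝ)
  set C : ℝ≥0 := (Fintype.card (Fin d) : ℝ≥0) ^ (1 / (2 : ℝ≥0∞)).toReal with hC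
  refine ⟨C, fun n hn => ?_⟩
  have hn' : (0 : ℝ) < n := Nat.cast_pos.2 hn
  refine ⟨fun f => WithLp.toLp 2 '' Set.pi univ fun i =>
    Icc ((f i : ℝ) / n) (((f i : ℝ) + 1) / n), fun f => ?_, fun x hx => ?_⟩
  · refine (hL.ediam_image_le _).trans ?_
    rw [div_eq_mul_inv, ENNReal.coe_mul]
    gcongr
    refine ediam_pi_le_of_le fun i => ?_
    rw [Real.ediam_Icc, add_div, add_sub_cancel_left, ENNReal.ofReal, one_div]
    simp [Real.toNNReal_inv]
  · refine mem_iUnion.2 ⟨fun i => ⟨⌊x i * n⌋₊, ?_⟩, WithLp.ofLp x, fun i _ => ⟨?_, ?_⟩, rfl⟩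
    · rw [Nat.floor_lt (mul_nonneg (hx i).1.le hn'.le)]
      nlinarith [(hx i).2]
    · rw [div_le_iff₀ hn']
      exact Nat.floor_le (mul_nonneg (hx i).1.le hn'.le)
    · rw [le_div_iff₀ hn']
      exact (Nat.lt_floor_add_one _).le

/-- If `h r ≤ M * r ^ d` for arbitrarily small `r`, the unit cube has finite measure. -/
theorem mkMetric_unit_cube_ne_top (d : ℕ) {h : ℝ≥0∞ → ℝ≥0∞} (hmono : Monotone h) {M : ℝ≥0∞}
    (hM : M ≠ ∞) (hf : ∃ᶠ r in 𝓝[>] (0 : ℝ≥0∞), h r ≤ M * r ^ d) :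
    Measure.mkMetric h {x : EuclideanSpace ℝ (Fin d) | ∀ i, x i ∈ Ioo (0 : ℝ) 1} ≠ ∞ := by
  obtain ⟨C, hC⟩ := exists_cover_unit_cube d
  let N : ℝ≥0∞ → ℕ := fun r => ⌊C / r.toNNReal⌋₊ + 1
  choose t ht hst using fun r : ℝ≥0∞ => hC (N r) (Nat.succ_pos _)
  let l : Filter ℝ≥0∞ := 𝓝[>] 0 ⊓ 𝓟 {r | h r ≤ M * r ^ d}
  have : l.NeBot := frequently_mem_iff_neBot.1 hf
  have hl0 : ∀ᶠ r in l, r ∈ Ioo (0 : ℝ≥0∞) 1 :=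
    mem_inf_of_left (Ioo_mem_nhdsGT one_pos)
  have hlM : ∀ᶠ r in l, h r ≤ M * r ^ d := mem_inf_of_right (mem_principal_self _)
  have hdiam : ∀ᶠ r in l, ∀ f, ediam (t r f) ≤ r := by
    filter_upwards [hl0] with r hr f
    refine (ht r f).trans ?_
    lift r to ℝ≥0 using (hr.2.trans one_lt_top).ne
    have hr0 : 0 < r := by simpa using hr.1
    have := (Nat.lt_floor_add_one (C / r)).le
    rw [div_le_iff₀ hr0] at this
    rw [ENNReal.coe_le_coe]
    refine div_le_of_le_mul₀ (by positivity) (by positivity) ?_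
    simpa [N, mul_comm] using this
  have hle := Measure.mkMetric_le_liminf_sum
    {x : EuclideanSpace ℝ (Fin d) | ∀ i, x i ∈ Ioo (0 : ℝ) 1} (l := l) id
    (tendsto_id.mono_left (inf_le_left.trans nhdsWithin_le_nhds)) t hdiam
    (Eventually.of_forall hst) h
  have hbound : ∀ᶠ r in l, ∑ f, h (ediam (t r f)) ≤ M * (C + 1 : ℝ≥0) ^ d := by
    filter_upwards [hl0, hlM, hdiam] with r hr hrM hd
    calc ∑ f, h (ediam (t r f)) ≤ ∑ _f : Fin d → Fin (N r), M * r ^ d :=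
          Finset.sum_le_sum fun f _ => (hmono (hd f)).trans hrM
      _ = M * ((N r : ℝ≥0∞) * r) ^ d := by
          simp [mul_pow]; ring
      _ ≤ M * (C + 1 : ℝ≥0) ^ d := by
          gcongr
          lift r to ℝ≥0 using (hr.2.trans one_lt_top).ne
          have hr0 : 0 < r := by simpa using hr.1
          have hr1 : r ≤ 1 := by simpa using hr.2.le
          have := Nat.floor_le (zero_le (a := C / r))
          rw [le_div_iff₀ hr0] at this
          have key : (N r : ℝ≥0) * r ≤ C + 1 := by
            simp only [N, toNNReal_coe, Nat.cast_add, Nat.cast_one, add_mul, one_mul]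
            exact add_le_add this hr1
          exact_mod_cast key
  have hlim : liminf (fun r => ∑ f, h (ediam (t r f))) l ≤ M * (C + 1 : ℝ≥0) ^ d := by
    refine liminf_le_of_le (by isBoundedDefault) fun b hb => ?_
    obtain ⟨r, h1, h2⟩ := (hb.and hbound).exists
    exact h1.trans h2
  exact ((hle.trans hlim).trans_lt
    (ENNReal.mul_lt_top hM.lt_top (ENNReal.pow_lt_top coe_lt_top))).ne

/-- If `h` eventually dominates every multiple of `r ^ d`, every set of positive Lebesgue measure
has infinite measure. -/
theorem mkMetric_eq_top_of_eventually_lt (d : ℕ) (hd : 1 ≤ d) {h : ℝ≥0∞ → ℝ≥0∞}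
    (hf : ∀ n : ℕ, ∀ᶠ r in 𝓝[>] (0 : ℝ≥0∞), n * r ^ d < h r)
    {K : Set (EuclideanSpace ℝ (Fin d))} (hK : 0 < volume K) :
    Measure.mkMetric h K = ∞ := by
  have hHaar : (μH[d] : Measure (EuclideanSpace ℝ (Fin d))).IsAddHaarMeasure := by
    simpa using isAddHaarMeasure_hausdorffMeasure (E := EuclideanSpace ℝ (Fin d))
  have hKH : μH[d] K ≠ 0 := fun h0 =>
    hK.ne' (Measure.absolutelyContinuous_isAddHaarMeasure volume μH[d] h0)
  by_contra htop
  obtain ⟨n, hn0, hn⟩ := ENNReal.exists_nat_pos_mul_gt hKH htop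
  have hn0' : (n : ℝ≥0∞) ≠ 0 := by exact_mod_cast hn0.ne'
  refine hn.not_ge ?_
  have hle : (μH[d] : Measure (EuclideanSpace ℝ (Fin d))) ≤ (n : ℝ≥0∞)⁻¹ • Measure.mkMetric h := by
    refine Measure.mkMetric_mono_smul (by simpa using hn0.ne') (by simp) ?_
    rw [← Ioi_insert, nhdsWithin_insert]
    refine eventually_sup.2 ⟨?_, ?_⟩
    · simp [zero_pow (by lia : d ≠ 0)]
    · filter_upwards [hf n] with r hr
      rw [ENNReal.rpow_natCast, Pi.smul_apply, smul_eq_mul,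
        ← ENNReal.mul_le_iff_le_inv hn0' (natCast_ne_top n)]
      exact hr.le
  have := hle K
  rwa [Measure.smul_apply, smul_eq_mul, ← ENNReal.mul_le_iff_le_inv hn0' (natCast_ne_top n)] at this

open MeasureTheory Set ENNReal

/-- Let `h` be a right-continuous increasing gauge function with `h 0 = 0` and let `ν` be the
Hausdorff measure (Borel measure) on `ℝ^d` corresponding to `h`. If there is a compact set
`K` with `ν K = λ K` and `0 < λ K < ∞`, then `ν` coincides with Lebesgue measure on all
Borel sets. -/
theorem hausdorff_eq_lebesgue_of_compact (d : ℕ) (hd : 1 ≤ d)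
    (h : ℝ≥0∞ → ℝ≥0∞) (h0 : h 0 = 0) (hmono : Monotone h)
    (hrc : ∀ x : ℝ≥0∞, ContinuousWithinAt h (Set.Ici x) x)
    (K : Set (EuclideanSpace ℝ (Fin d))) (hK : IsCompact K)
    (hνK : Measure.mkMetric h K = volume K) (hpos : 0 < volume K) (hfin : volume K < ⊤) :
    ∀ A : Set (EuclideanSpace ℝ (Fin d)), MeasurableSet A →
      Measure.mkMetric h A = volume A := by
  intro A _
  have := isAddLeftInvariant_mkMetric (E := EuclideanSpace ℝ (Fin d)) h
  obtain ⟨M, hM, hf⟩ : ∃ M : ℝ≥0∞, M ≠ ∞ ∧ ∃ᶠ r in 𝓝[>] (0 : ℝ≥0∞), h r ≤ M * r ^ d := by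
    by_contra! hcon
    refine (hνK.trans_lt hfin).ne (mkMetric_eq_top_of_eventually_lt d hd (fun n => ?_) hpos)
    simpa using hcon n (natCast_ne_top n)
  have hcube := mkMetric_unit_cube_ne_top d hmono hM hf
  have hopen : IsOpen {x : EuclideanSpace ℝ (Fin d) | ∀ i, x i ∈ Ioo (0 : ℝ) 1} := by
    simp only [ofPred_forall]
    exact isOpen_iInter_of_finite fun i => isOpen_Ioo.preimage (by fun_prop)
  have hne : {x : EuclideanSpace ℝ (Fin d) | ∀ i, x i ∈ Ioo (0 : ℝ) 1}.Nonempty :=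
    ⟨WithLp.toLp 2 fun _ => 1 / 2, fun i => by norm_num⟩
  have : IsFiniteMeasureOnCompacts (Measure.mkMetric h : Measure (EuclideanSpace ℝ (Fin d))) :=
    ⟨fun _ hL => measure_lt_top_of_isCompact_of_isAddLeftInvariant _ hopen hne hcube hL⟩
  have heq := Measure.isAddLeftInvariant_eq_smul
    (Measure.mkMetric h : Measure (EuclideanSpace ℝ (Fin d))) volume
  set c := Measure.addHaarScalarFactor
    (Measure.mkMetric h : Measure (EuclideanSpace ℝ (Fin d))) volume
  have hc : (c : ℝ≥0∞) = 1 := by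
    rw [heq, Measure.smul_apply, ENNReal.smul_def, smul_eq_mul] at hνK
    exact (ENNReal.mul_eq_right hpos.ne' hfin.ne).1 hνK
  rw [heq, Measure.smul_apply, ENNReal.smul_def, hc, one_smul]
end

section
/- Let d ≥ 1, let h : [0,∞) → [0,∞] be a right-continuous increasing function with h(0) = 0, and let ν be the Hausdorff measure corresponding to h on ℝ^d. If there exists a compact set K ⊆ ℝ^d such that ν(K) = λ(K) and 0 < λ(K) < ∞, then there exists a cube Q = [0, α]^d with α > 0 such that 0 < ν(Q) < ∞. -/
open MeasureTheory Set ENNReal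

/-- Lebesgue measure on Euclidean space is at most the Hausdorff measure of the same dimension
(normalised with gauge `r ↦ r ^ d`). -/
theorem EuclideanSpace.volume_le_hausdorffMeasure {d : ℕ} (s : Set (EuclideanSpace ℝ (Fin d)))
    (hs : MeasurableSet s) : volume s ≤ Measure.hausdorffMeasure (d : ℝ) s := by
  have hvol : volume ((WithLp.ofLp : EuclideanSpace ℝ (Fin d) → Fin d → ℝ) '' s) = volume s := by
    have := (EuclideanSpace.volume_preserving_symm_measurableEquiv_toLp (Fin d)).symm.measure_preimage
      hs.nullMeasurableSet
    rw [← this]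
    congr 1
    exact (EuclideanSpace.equiv (Fin d) ℝ).toEquiv.image_eq_preimage_symm s
  have hlip := (PiLp.lipschitzWith_ofLp 2 (fun _ : Fin d => ℝ)).hausdorffMeasure_image_le
    (Nat.cast_nonneg d) s
  have hpi := hausdorffMeasure_pi_real (ι := Fin d)
  rw [Fintype.card_fin] at hpi
  rw [hpi, ENNReal.coe_one, ENNReal.one_rpow, one_mul] at hlip
  exact hvol.symm.trans_le hlip

/-- A set whose coordinates vary by at most `ε` has diameter at most `d * ε`. -/
theorem EuclideanSpace.ediam_le_of_forall_abs_sub_le {d : ℕ} {s : Set (EuclideanSpace ℝ (Fin d))}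
    {ε : ℝ} (hε : 0 ≤ ε) (h : ∀ x ∈ s, ∀ y ∈ s, ∀ i, |x i - y i| ≤ ε) :
    Metric.ediam s ≤ ENNReal.ofReal (d * ε) := by
  refine Metric.ediam_le fun x hx y hy => ?_
  rw [edist_dist]
  refine ENNReal.ofReal_le_ofReal ?_
  rw [EuclideanSpace.dist_eq]
  refine Real.sqrt_le_iff.mpr ⟨by positivity, ?_⟩
  calc ∑ i, dist (x i) (y i) ^ 2 ≤ ∑ _i : Fin d, ε ^ 2 := by
        gcongr with i
        exact h x hx y hy i
    _ = d * ε ^ 2 := by simp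
    _ ≤ (d : ℝ) ^ 2 * ε ^ 2 := by
        gcongr
        exact_mod_cast Nat.le_self_pow two_ne_zero d
    _ = (d * ε) ^ 2 := by ring

/-- The unit interval is covered by the `n` intervals `[k / n, (k + 1) / n]`, `k < n`. -/
theorem exists_fin_mul_mem_Icc {n : ℕ} (hn : 0 < n) {x : ℝ} (hx : x ∈ Icc (0 : ℝ) 1) :
    ∃ k : Fin n, (n : ℝ) * x ∈ Icc (k : ℝ) (k + 1) := by
  rcases eq_or_lt_of_le hx.2 with rfl | hx1
  · refine ⟨⟨n - 1, by omega⟩, ?_⟩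
    simp only [Nat.cast_sub (show 1 ≤ n from hn), Nat.cast_one, mem_Icc]
    constructor <;> linarith
  · have hn' : (0 : ℝ) < n := Nat.cast_pos.mpr hn
    have hnx : 0 ≤ (n : ℝ) * x := mul_nonneg hn'.le hx.1
    refine ⟨⟨⌊(n : ℝ) * x⌋₊, (Nat.floor_lt hnx).mpr (by nlinarith)⟩, Nat.floor_le hnx,
      (Nat.lt_floor_add_one _).le⟩

open Filter Topology in
/-- If `h r ≤ C * r ^ d` for arbitrarily small `r > 0`, then the Hausdorff measure with gauge `h`
of the unit cube is finite. -/
theorem mkMetric_unitCube_lt_top {d : ℕ} {h : ℝ≥0∞ → ℝ≥0∞} (hmono : Monotone h) {C : ℝ≥0∞}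
    (hC : C ≠ ⊤) (hf : ∃ᶠ r in 𝓝[>] (0 : ℝ≥0∞), h r ≤ C * r ^ d) :
    Measure.mkMetric h {x : EuclideanSpace ℝ (Fin d) | ∀ i, x i ∈ Icc (0 : ℝ) 1} < ⊤ := by
  let l : Filter ℝ≥0∞ := 𝓝[>] 0 ⊓ 𝓟 {r | h r ≤ C * r ^ d}
  have hne : l.NeBot := frequently_mem_iff_neBot.mp hf
  let N : ℝ≥0∞ → ℕ := fun r => ⌈((d : ℝ) + 1) / r.toReal⌉₊
  let t : ∀ r : ℝ≥0∞, (Fin d → Fin (N r)) → Set (EuclideanSpace ℝ (Fin d)) :=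
    fun r k => {x | ∀ i, (N r : ℝ) * x i ∈ Icc ((k i : ℕ) : ℝ) ((k i : ℕ) + 1)}
  have hsmall : ∀ᶠ r in l, r ∈ Ioo (0 : ℝ≥0∞) 1 :=
    (mem_inf_of_left (Ioo_mem_nhdsGT one_pos) : _ ∈ l)
  have hgauge : ∀ᶠ r in l, h r ≤ C * r ^ d := mem_inf_of_right (mem_principal_self _)
  have hreal : ∀ r ∈ Ioo (0 : ℝ≥0∞) 1, 0 < r.toReal ∧ r.toReal ≤ 1 ∧ 0 < (N r : ℝ) := by
    intro r hr
    have h1 : 0 < r.toReal := ENNReal.toReal_pos hr.1.ne' (hr.2.trans one_lt_top).ne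
    refine ⟨h1, ENNReal.toReal_le_of_le_ofReal zero_le_one (by simpa using hr.2.le), ?_⟩
    exact Nat.cast_pos.mpr (Nat.ceil_pos.mpr (by positivity))
  have hdiam : ∀ r ∈ Ioo (0 : ℝ≥0∞) 1, ∀ k, Metric.ediam (t r k) ≤ r := by
    intro r hr k
    obtain ⟨hr0, -, hN⟩ := hreal r hr
    refine (EuclideanSpace.ediam_le_of_forall_abs_sub_le (ε := 1 / N r) (by positivity)
      fun x hx y hy i => ?_).trans ?_
    · have hx' := hx i
      have hy' := hy i
      rw [le_div_iff₀ hN, ← abs_of_pos hN, ← abs_mul, abs_le]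
      constructor <;> nlinarith [hx'.1, hx'.2, hy'.1, hy'.2]
    · refine ENNReal.ofReal_le_of_le_toReal ?_
      have hceil : ((d : ℝ) + 1) / r.toReal ≤ N r := Nat.le_ceil _
      rw [div_le_iff₀ hr0] at hceil
      rw [mul_one_div, div_le_iff₀ hN]
      linarith
  have hcard : ∀ r ∈ Ioo (0 : ℝ≥0∞) 1, (N r : ℝ≥0∞) * r ≤ (d + 2 : ℕ) := by
    intro r hr
    obtain ⟨hr0, hr1, -⟩ := hreal r hr
    have hceil : (N r : ℝ) < ((d : ℝ) + 1) / r.toReal + 1 := Nat.ceil_lt_add_one (by positivity)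
    have hrtop : r ≠ ⊤ := (hr.2.trans one_lt_top).ne
    rw [← ENNReal.toReal_le_toReal (ENNReal.mul_ne_top (ENNReal.natCast_ne_top _) hrtop)
      (ENNReal.natCast_ne_top _), ENNReal.toReal_mul, ENNReal.toReal_natCast,
      ENNReal.toReal_natCast]
    calc (N r : ℝ) * r.toReal ≤ (((d : ℝ) + 1) / r.toReal + 1) * r.toReal := by gcongr
      _ = d + 1 + r.toReal := by field_simp
      _ ≤ (d + 2 : ℕ) := by push_cast; linarith
  have hlim := Measure.mkMetric_le_liminf_sum
    {x : EuclideanSpace ℝ (Fin d) | ∀ i, x i ∈ Icc (0 : ℝ) 1} (l := l) (fun r => r)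
    (tendsto_id.mono_left (inf_le_left.trans nhdsWithin_le_nhds)) t (hsmall.mono hdiam)
    (hsmall.mono fun r hr x hx => by
      have hN : 0 < N r := by exact_mod_cast (hreal r hr).2.2
      choose k hk using fun i => exists_fin_mul_mem_Icc hN (hx i)
      exact mem_iUnion.mpr ⟨k, hk⟩) h
  refine hlim.trans_lt (lt_of_le_of_lt (b := C * ((d + 2 : ℕ) : ℝ≥0∞) ^ d) ?_
    (ENNReal.mul_lt_top hC.lt_top (ENNReal.pow_lt_top (ENNReal.natCast_lt_top _))))
  refine liminf_le_of_frequently_le' (Eventually.frequently ?_)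
  filter_upwards [hsmall, hgauge] with r hr hhr
  calc ∑ k, h (Metric.ediam (t r k)) ≤ ∑ _k : Fin d → Fin (N r), C * r ^ d := by
        gcongr with k
        exact (hmono (hdiam r hr k)).trans hhr
    _ = C * ((N r : ℝ≥0∞) * r) ^ d := by
        simp [mul_pow]
        ring
    _ ≤ C * ((d + 2 : ℕ) : ℝ≥0∞) ^ d := by
        gcongr
        exact hcard r hr

/-- Hausdorff measures are translation invariant. -/
theorem mkMetric_image_add_left {d : ℕ} (h : ℝ≥0∞ → ℝ≥0∞) (a : EuclideanSpace ℝ (Fin d))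
    (s : Set (EuclideanSpace ℝ (Fin d))) :
    Measure.mkMetric h ((a + ·) '' s) = Measure.mkMetric h s := by
  have := OuterMeasure.isometryEquiv_comap_mkMetric h (IsometryEquiv.addLeft a)
  rw [← OuterMeasure.coe_mkMetric]
  conv_rhs => rw [← this]
  rfl

/-- If the Hausdorff measure with some gauge vanishes on the unit cube, then it is zero. -/
theorem mkMetric_eq_zero_of_unitCube {d : ℕ} {h : ℝ≥0∞ → ℝ≥0∞}
    (hQ : Measure.mkMetric h {x : EuclideanSpace ℝ (Fin d) | ∀ i, x i ∈ Icc (0 : ℝ) 1} = 0)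
    (s : Set (EuclideanSpace ℝ (Fin d))) : Measure.mkMetric h s = 0 := by
  refine measure_mono_null (t := ⋃ z : Fin d → ℤ,
    ((WithLp.toLp 2 fun i => (z i : ℝ)) + ·) ''
      {x : EuclideanSpace ℝ (Fin d) | ∀ i, x i ∈ Icc (0 : ℝ) 1}) (fun x _ => ?_)
    (measure_iUnion_null fun z => by rw [mkMetric_image_add_left, hQ])
  refine mem_iUnion.mpr ⟨fun i => ⌊x i⌋, WithLp.toLp 2 fun i => Int.fract (x i),
    fun i => ⟨Int.fract_nonneg _, (Int.fract_lt_one _).le⟩, ?_⟩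
  ext i
  simp

open Filter Topology in
/-- If `ν` is the Hausdorff measure with gauge `h` and `ν K = λ K` for some compact `K` of positive
measure, then `h r ≤ 2 * r ^ d` for arbitrarily small `r > 0`. -/
theorem frequently_gauge_le_of_mkMetric_eq_volume {d : ℕ} (hd : 1 ≤ d) {h : ℝ≥0∞ → ℝ≥0∞}
    {K : Set (EuclideanSpace ℝ (Fin d))} (hK : IsCompact K)
    (hνK : Measure.mkMetric h K = volume K) (hpos : 0 < volume K) (hfin : volume K < ⊤) :
    ∃ᶠ r in 𝓝[>] (0 : ℝ≥0∞), h r ≤ 2 * r ^ d := by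
  intro hev
  have hle : (fun r : ℝ≥0∞ => r ^ (d : ℝ)) ≤ᶠ[𝓝[≥] 0] (2⁻¹ : ℝ≥0∞) • h := by
    rw [← Ioi_insert, EventuallyLE, nhdsWithin_insert, eventually_sup]
    refine ⟨by simp [show d ≠ 0 by omega], hev.mono fun r hr => ?_⟩
    rw [ENNReal.rpow_natCast, Pi.smul_apply, smul_eq_mul, mul_comm, ← div_eq_mul_inv,
      ENNReal.le_div_iff_mul_le (by simp) (by simp), mul_comm]
    exact (not_le.mp hr).le
  have hcmp := Measure.mkMetric_mono_smul (X := EuclideanSpace ℝ (Fin d)) (by simp) (by simp) hle K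
  rw [Measure.smul_apply, hνK, smul_eq_mul] at hcmp
  have hhalf := (EuclideanSpace.volume_le_hausdorffMeasure K hK.measurableSet).trans hcmp
  rw [mul_comm, ← div_eq_mul_inv] at hhalf
  exact hhalf.not_gt (ENNReal.half_lt_self hpos.ne' hfin.ne)

open MeasureTheory Set ENNReal

/-- Let `h` be a right-continuous increasing gauge function with `h 0 = 0` and let `ν` be the
Hausdorff measure on `ℝ^d` corresponding to `h`. If there is a compact set `K` with
`ν K = λ K` and `0 < λ K < ∞`, then there exists a cube `Q = [0, α]^d`, `α > 0`, with
`0 < ν Q < ∞`. -/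
theorem hausdorff_exists_cube_pos_finite (d : ℕ) (hd : 1 ≤ d)
    (h : ℝ≥0∞ → ℝ≥0∞) (h0 : h 0 = 0) (hmono : Monotone h)
    (hrc : ∀ x : ℝ≥0∞, ContinuousWithinAt h (Set.Ici x) x)
    (K : Set (EuclideanSpace ℝ (Fin d))) (hK : IsCompact K)
    (hνK : Measure.mkMetric h K = volume K) (hpos : 0 < volume K) (hfin : volume K < ⊤) :
    ∃ α : ℝ, 0 < α ∧
      0 < Measure.mkMetric h {x : EuclideanSpace ℝ (Fin d) | ∀ i, x i ∈ Set.Icc 0 α} ∧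
      Measure.mkMetric h {x : EuclideanSpace ℝ (Fin d) | ∀ i, x i ∈ Set.Icc 0 α} < ⊤ := by
  refine ⟨1, one_pos, pos_iff_ne_zero.mpr fun hQ => ?_, mkMetric_unitCube_lt_top hmono (by simp)
    (frequently_gauge_le_of_mkMetric_eq_volume hd hK hνK hpos hfin)⟩
  exact hpos.ne' (hνK ▸ mkMetric_eq_zero_of_unitCube hQ K)
end

section
/- Let d ≥ 1. There exists a measure μ on the Borel σ-algebra of ℝ^d that is translation invariant, whose range { μ(A) : A Borel } is all of [0, ∞], and which is not a Hausdorff measure, i.e. for every right-continuous increasing function h : [0,∞) → [0,∞] with h(0) = 0, μ does not coincide on the Borel sets with the Hausdorff measure corresponding to h. -/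
open MeasureTheory Set ENNReal

/-- A measure on `ℝ^d` is translation invariant if the measure of every translate of a
Borel set equals the measure of the set. -/
def TranslationInvariant {d : ℕ} (μ : Measure (EuclideanSpace ℝ (Fin d))) : Prop :=
  ∀ (A : Set (EuclideanSpace ℝ (Fin d))) (x : EuclideanSpace ℝ (Fin d)),
    MeasurableSet A → μ ((fun y => y + x) '' A) = μ A

open Filter Topology

/-- A nonempty separable metric space has a dense Gδ subset that is null for the Hausdorff measure
of any gauge that vanishes continuously at `0`. -/
lemma exists_dense_isGδ_mkMetric_eq_zero {X : Type*} [MetricSpace X] [MeasurableSpace X]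
    [BorelSpace X] [TopologicalSpace.SeparableSpace X] [Nonempty X] {h : ℝ≥0∞ → ℝ≥0∞}
    (h0 : h 0 = 0) (hc : ContinuousAt h 0) :
    ∃ G : Set X, IsGδ G ∧ Dense G ∧ Measure.mkMetric h G = 0 := by
  have hsmall : ∀ ε : ℝ≥0∞, 0 < ε → ∃ r : ℝ≥0∞, 0 < r ∧ ∀ t ≤ r, h t < ε := by
    intro ε hε
    have hev : ∀ᶠ t in 𝓝 (0 : ℝ≥0∞), h t < ε := hc.eventually (gt_mem_nhds (h0.symm ▸ hε))
    obtain ⟨r, hr, hrε⟩ := ENNReal.nhds_zero_basis_Iic.eventually_iff.1 hev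
    exact ⟨r, hr, fun t ht => hrε ht⟩
  let δ : ℕ → ℝ≥0∞ := fun n => (n + 1 : ℝ≥0∞)⁻¹
  have hδ0 : ∀ n, 0 < δ n := fun n => ENNReal.inv_pos.2 (by finiteness)
  have hδ : Tendsto δ atTop (𝓝 0) := by
    have := (tendsto_add_atTop_iff_nat 1).2 ENNReal.tendsto_inv_nat_nhds_zero
    simpa [δ] using this
  choose w hw0 hw using fun n => ENNReal.exists_pos_sum_of_countable' (hδ0 n).ne' ℕ
  choose ρ hρ0 hρ using fun n k => hsmall (w n k) (hw0 n k)
  let r : ℕ → ℕ → ℝ≥0∞ := fun n k => min (ρ n k) (δ n) / 2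
  let q := TopologicalSpace.denseSeq X
  let U : ℕ → ℕ → Set X := fun n k => Metric.eball (q k) (r n k)
  have hdiam : ∀ n k, Metric.ediam (U n k) ≤ min (ρ n k) (δ n) := fun n k =>
    Metric.ediam_eball_le.trans (ENNReal.mul_div_cancel (by simp) (by simp)).le
  have hq : range q ⊆ ⋂ n, ⋃ k, U n k := by
    rintro _ ⟨k, rfl⟩
    refine mem_iInter.2 fun n => mem_iUnion.2 ⟨k, Metric.mem_eball_self ?_⟩
    exact ENNReal.half_pos (lt_min (hρ0 n k) (hδ0 n)).ne'
  refine ⟨⋂ n, ⋃ k, U n k, .iInter_of_isOpen fun n => isOpen_iUnion fun k => Metric.isOpen_eball,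
    (TopologicalSpace.denseRange_denseSeq X).mono hq, nonpos_iff_eq_zero.1 ?_⟩
  refine (Measure.mkMetric_le_liminf_tsum _ δ hδ U
    (.of_forall fun n k => (hdiam n k).trans (min_le_right _ _))
    (.of_forall fun n => iInter_subset _ n) h).trans ?_
  rw [← hδ.liminf_eq]
  refine liminf_le_liminf (.of_forall fun n => ?_)
  exact (ENNReal.tsum_le_tsum fun k =>
    (hρ n k _ ((hdiam n k).trans (min_le_left _ _))).le).trans (hw n).le

open Classical in
/-- The Borel measure that is `0` on meagre sets and `∞` on all other Borel sets. -/
noncomputable def nonmeagreMeasure (X : Type*) [TopologicalSpace X] [MeasurableSpace X] :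
    Measure X :=
  Measure.ofMeasurable (fun s _ => if IsMeagre s then 0 else ∞) (if_pos .empty) <| by
    intro f _ _
    by_cases hf : ∀ i, IsMeagre (f i)
    · simp [hf, isMeagre_iUnion hf]
    · have hU : ¬ IsMeagre (⋃ i, f i) := fun hU => hf fun i => hU.mono (subset_iUnion f i)
      obtain ⟨i, hi⟩ := not_forall.1 hf
      rw [if_neg hU, eq_comm]
      exact ENNReal.tsum_eq_top_of_eq_top ⟨i, if_neg hi⟩

section nonmeagreMeasure

variable {X : Type*} [TopologicalSpace X] [MeasurableSpace X] {s : Set X}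

lemma nonmeagreMeasure_of_isMeagre (hm : MeasurableSet s) (hs : IsMeagre s) :
    nonmeagreMeasure X s = 0 := by
  rw [nonmeagreMeasure, Measure.ofMeasurable_apply s hm, if_pos hs]

lemma nonmeagreMeasure_of_not_isMeagre (hm : MeasurableSet s) (hs : ¬ IsMeagre s) :
    nonmeagreMeasure X s = ∞ := by
  rw [nonmeagreMeasure, Measure.ofMeasurable_apply s hm, if_neg hs]

lemma nonmeagreMeasure_preimage_homeomorph [BorelSpace X] (e : X ≃ₜ X) (hm : MeasurableSet s) :
    nonmeagreMeasure X (e ⁻¹' s) = nonmeagreMeasure X s := by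
  have hm' : MeasurableSet (e ⁻¹' s) := e.continuous.measurable hm
  by_cases hs : IsMeagre s
  · rw [nonmeagreMeasure_of_isMeagre hm hs, nonmeagreMeasure_of_isMeagre hm'
      (hs.preimage_of_isOpenMap e.continuous e.isOpenMap)]
  · rw [nonmeagreMeasure_of_not_isMeagre hm hs, nonmeagreMeasure_of_not_isMeagre hm']
    intro h
    apply hs
    simpa [← preimage_comp] using
      h.preimage_of_isOpenMap e.symm.continuous e.symm.isOpenMap

end nonmeagreMeasure

/-- A Haar measure on a nontrivial real vector space takes every value on closed balls and the
whole space. -/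
lemma exists_measurableSet_addHaar_eq {E : Type*} [NormedAddCommGroup E] [NormedSpace ℝ E]
    [MeasurableSpace E] [BorelSpace E] [FiniteDimensional ℝ E] [Nontrivial E] (ν : Measure E)
    [ν.IsAddHaarMeasure] (c : ℝ≥0∞) : ∃ A, MeasurableSet A ∧ ν A = c := by
  rcases eq_or_ne c ∞ with rfl | hc
  · exact ⟨univ, .univ, measure_univ_of_isAddLeftInvariant ν⟩
  set b := ν (Metric.ball 0 1)
  have hb0 : b ≠ 0 := (Metric.measure_ball_pos ν 0 one_pos).ne'
  have hb : b ≠ ∞ := measure_ball_lt_top.ne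
  have hcb : c / b ≠ ∞ := ENNReal.div_ne_top hc hb0
  refine ⟨Metric.closedBall 0 ((c / b).toReal ^ (Module.finrank ℝ E : ℝ)⁻¹),
    Metric.isClosed_closedBall.measurableSet, ?_⟩
  rw [Measure.addHaar_closedBall ν 0 (by positivity),
    Real.rpow_inv_natCast_pow ENNReal.toReal_nonneg Module.finrank_pos.ne',
    ENNReal.ofReal_toReal hcb, ENNReal.div_mul_cancel hb0 hb]

/-- There exists a translation invariant Borel measure on `ℝ^d` whose range over Borel sets
is all of `[0, ∞]` and which is not a Hausdorff measure: for every right-continuous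
increasing gauge `h` with `h 0 = 0`, it does not coincide on the Borel sets with the
Hausdorff measure corresponding to `h`. -/
theorem exists_translation_invariant_full_range_not_hausdorff (d : ℕ) (hd : 1 ≤ d) :
    ∃ μ : Measure (EuclideanSpace ℝ (Fin d)),
      TranslationInvariant μ ∧
      (∀ c : ℝ≥0∞, ∃ A : Set (EuclideanSpace ℝ (Fin d)), MeasurableSet A ∧ μ A = c) ∧
      ∀ h : ℝ≥0∞ → ℝ≥0∞, h 0 = 0 → Monotone h →
        (∀ x : ℝ≥0∞, ContinuousWithinAt h (Set.Ici x) x) →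
        ¬ (∀ A : Set (EuclideanSpace ℝ (Fin d)), MeasurableSet A →
            μ A = Measure.mkMetric h A) := by
  have : NeZero d := ⟨by omega⟩
  let E := EuclideanSpace ℝ (Fin d)
  let ν : Measure E := Measure.hausdorffMeasure (Module.finrank ℝ E)
  have : ν.IsAddHaarMeasure := isAddHaarMeasure_hausdorffMeasure
  refine ⟨ν + nonmeagreMeasure E, fun A x hA => ?_, fun c => ?_, fun h h0 _ hc heq => ?_⟩
  · have himage : (fun y => y + x) '' A = Homeomorph.addRight (-x) ⁻¹' A := by
      ext y
      simp [← sub_eq_add_neg]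
    rw [himage, Measure.add_apply, Measure.add_apply, nonmeagreMeasure_preimage_homeomorph _ hA]
    congr 1
    exact measure_preimage_add_right ν (-x) A
  · have hdim : (Module.finrank ℝ E : ℝ) ≠ 0 := Nat.cast_ne_zero.2 Module.finrank_pos.ne'
    obtain ⟨G, hG, hGd, hGν⟩ := exists_dense_isGδ_mkMetric_eq_zero (X := E)
      (h := fun r => r ^ (Module.finrank ℝ E : ℝ))
      (ENNReal.zero_rpow_of_pos (by positivity)) ENNReal.continuous_rpow_const.continuousAt
    obtain ⟨A, hA, rfl⟩ := exists_measurableSet_addHaar_eq ν c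
    have hmeagre : IsMeagre (A \ G) := by
      refine IsMeagre.mono (sdiff_subset_compl A G) ?_
      rw [IsMeagre, compl_compl]
      exact residual_of_dense_Gδ hG hGd
    have hm : MeasurableSet (A \ G) := hA.diff hG.measurableSet
    refine ⟨A \ G, hm, ?_⟩
    rw [Measure.add_apply, nonmeagreMeasure_of_isMeagre hm hmeagre, add_zero]
    exact measure_sdiff_null hGν
  · have hc0 : ContinuousAt h 0 := by
      have huniv : Ici (0 : ℝ≥0∞) = univ := Ici_bot
      simpa [huniv, continuousWithinAt_univ] using hc 0
    obtain ⟨G, hG, hGd, hGh⟩ := exists_dense_isGδ_mkMetric_eq_zero (X := E) h0 hc0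
    have htop := heq G hG.measurableSet
    rw [hGh, Measure.add_apply, nonmeagreMeasure_of_not_isMeagre hG.measurableSet
      (not_isMeagre_of_isGδ_of_dense hG hGd)] at htop
    simp at htop
end
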